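/- For every integer k ≥ 2 and every n ∈ ℕ, the word s_k^{n+k}(0) equals the concatenation s_k^{n+k−1}(0) · s_k^{n+k−2}(0) · … · s_k^{n}(0) of the k words s_k^{n+k−1-i}(0) for i = 0, …, k−1. -/

import Mathlib

/-- The `k`-bonacci substitution on letters: `a ↦ 0(a+1)` if `a ≠ k-1`, and `k-1 ↦ 0`. -/
def sLetter {k : ℕ} (a : Fin k) : List (Fin k) :=
  if h : (a : ℕ) + 1 < k then
    [⟨0, Nat.lt_of_le_of_lt (Nat.zero_le _) a.isLt⟩, ⟨(a : ℕ) + 1, h⟩]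
  else
    [⟨0, Nat.lt_of_le_of_lt (Nat.zero_le _) a.isLt⟩]

/-- Extension of the substitution to finite words by concatenation. -/
def sWord {k : ℕ} (w : List (Fin k)) : List (Fin k) := w.flatMap sLetter

/-- The prefix of length `n` of a right-infinite sequence. -/
def pref {k : ℕ} (x : ℕ → Fin k) (n : ℕ) : List (Fin k) :=
  (List.range n).map x

/-- Extension of the substitution to right-infinite sequences, by concatenating the
images of the letters: since each letter has a nonempty image, the `m`-th letter of the
image is the `m`-th letter of the image of the prefix of length `m+1`. -/
def sSeq {k : ℕ} (x : ℕ → Fin k) : ℕ → Fin k :=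
  fun m => (sWord (pref x (m + 1))).getD m (x 0)

/-- The left shift on sequences. -/
def shift {k : ℕ} (x : ℕ → Fin k) : ℕ → Fin k := fun n => x (n + 1)

/-- The language of the substitution: finite words occurring as a subword of some `s^m(a)`. -/
def Lang {k : ℕ} (w : List (Fin k)) : Prop :=
  ∃ (a : Fin k) (m : ℕ), w <:+: sWord^[m] [a]

/-- `delta x = sup {n : prefix of x of length n is in the language}`, valued in `ℕ∞`. -/
noncomputable def delta {k : ℕ} (x : ℕ → Fin k) : ℕ∞ :=
  sSup {N : ℕ∞ | ∃ n : ℕ, N = (n : ℕ∞) ∧ Lang (pref x n)}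

/-- The subshift associated to the substitution: sequences all of whose subwords
lie in the language. -/
def Attr (k : ℕ) : Set (ℕ → Fin k) :=
  {x | ∀ i n, Lang ((List.range n).map (fun j => x (i + j)))}

/-- The renormalization operator. -/
noncomputable def Renorm {k : ℕ} (V : (ℕ → Fin k) → ℝ) : (ℕ → Fin k) → ℝ :=
  fun x => ∑ j ∈ Finset.range (sLetter (x 0)).length, V (shift^[j] (sSeq x))

/-- `vcoef k lam l = lam^{-(k-1-l)} * ∑_{j=0}^{k-1-l} lam^j`. -/
noncomputable def vcoef (k : ℕ) (lam : ℝ) (l : ℕ) : ℝ :=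
  (∑ j ∈ Finset.range (k - l), lam ^ j) / lam ^ (k - 1 - l)

/-- The fixed point of the renormalization operator. -/
noncomputable def Ufix (k : ℕ) (lam : ℝ) (x : ℕ → Fin k) : ℝ :=
  if delta x = ⊤ then 0
  else Real.log (1 + vcoef k lam (x 0) /
    (lam / (lam - 1)
      + (∑ l : Fin k, vcoef k lam (l : ℕ) * ((pref x (delta x).toNat).count l : ℝ))
      - vcoef k lam (x 0)))

/-- The word `s^n(0) · s^{n-1}(0) ⋯ s(0) · 0`. -/
def bword {k : ℕ} (z : Fin k) (n : ℕ) : List (Fin k) :=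
  ((List.range (n + 1)).map (fun i => sWord^[n - i] [z])).flatten

/-- The word `s^{n-1}(0) · s^{n-2}(0) ⋯ s(0) · 0`. -/
def bsuffix {k : ℕ} (z : Fin k) (n : ℕ) : List (Fin k) :=
  ((List.range n).map (fun i => sWord^[n - 1 - i] [z])).flatten

theorem sWord_append {k : ℕ} (u v : List (Fin k)) : sWord (u ++ v) = sWord u ++ sWord v :=
  List.flatMap_append

theorem iterate_sWord_append {k : ℕ} (m : ℕ) (u v : List (Fin k)) :
    sWord^[m] (u ++ v) = sWord^[m] u ++ sWord^[m] v := by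
  induction m generalizing u v with
  | zero => rfl
  | succ m ih => simp only [Function.iterate_succ_apply, sWord_append, ih]

theorem sWord_singleton {k : ℕ} (a : Fin k) : sWord [a] = sLetter a := by
  simp [sWord]

/-- The decomposition of `s^{n+d}(a)` into images of `0`, for the letter `a = k - d`. -/
theorem iterate_sWord_singleton {k : ℕ} (hk : 0 < k) (n d : ℕ) (a : Fin k)
    (h : (a : ℕ) + d = k) :
    sWord^[n + d] [a] =
      ((List.range d).map (fun i => sWord^[n + d - 1 - i] [(⟨0, hk⟩ : Fin k)])).flatten := by
  induction d generalizing a with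
  | zero => exact absurd h a.isLt.ne
  | succ d ih =>
    simp only [Nat.sub_sub, Nat.add_comm 1] at ih
    rw [← Nat.add_assoc, Function.iterate_succ_apply, sWord_singleton, List.range_succ_eq_map]
    simp only [List.map_cons, List.map_map, List.flatten_cons, Function.comp_def,
      Nat.add_sub_cancel, Nat.sub_zero, Nat.succ_eq_add_one]
    by_cases ha : (a : ℕ) + 1 < k
    · rw [← ih ⟨a + 1, ha⟩ (by simp only; omega), ← iterate_sWord_append]
      simp [sLetter, ha]
    · obtain rfl : d = 0 := by omega
      simp [sLetter, ha]

theorem stmt0 (k : ℕ) (hk : 2 ≤ k) (n : ℕ) :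
    sWord^[n + k] [(⟨0, by omega⟩ : Fin k)] =
      ((List.range k).map
        (fun i => sWord^[n + k - 1 - i] [(⟨0, by omega⟩ : Fin k)])).flatten := by
  exact iterate_sWord_singleton (by omega) n k ⟨0, by omega⟩ (Nat.zero_add k)
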